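/- Let n = 2m be a positive even integer. There exists an m×m Toeplitz matrix A over F_4 such that the double Toeplitz code C(A) has minimum weight at least 9 if and only if n ≥ 24. -/

import Mathlib

open Matrix

/-- An `m × m` matrix is Toeplitz if its entries are constant along diagonals. -/
def IsToeplitz {m : ℕ} {F : Type*} (A : Matrix (Fin m) (Fin m) F) : Prop :=
  ∀ i j i' j' : Fin m, (i : ℕ) + (j' : ℕ) = (i' : ℕ) + (j : ℕ) → A i j = A i' j'

/-- The double Toeplitz code `C(A) = {(x, xA) : x ∈ F^m}`. -/
def DTcode {m : ℕ} {F : Type*} [Field F] (A : Matrix (Fin m) (Fin m) F) :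
    Set (Fin m ⊕ Fin m → F) :=
  {c | ∃ x : Fin m → F, c = Sum.elim x (Matrix.vecMul x A)}

/-- The Hamming weight of a vector: the number of nonzero coordinates. -/
noncomputable def wt {ι : Type*} [Fintype ι] {F : Type*} [Zero F] (v : ι → F) : ℕ :=
  Nat.card {i // v i ≠ 0}

/-- The field with four elements `0, 1, ω, ω²`, as an enumerated type. -/
inductive Q4 | z | o | w | v
  deriving DecidableEq

namespace Q4

instance : Fintype Q4 := ⟨{z, o, w, v}, by rintro (_ | _ | _ | _) <;> decide⟩

/-- Addition in the field with four elements. -/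
def add : Q4 → Q4 → Q4
  | z, b => b
  | a, z => a
  | o, o => z | o, w => v | o, v => w
  | w, o => v | w, w => z | w, v => o
  | v, o => w | v, w => o | v, v => z

/-- Multiplication in the field with four elements. -/
def mul : Q4 → Q4 → Q4
  | z, _ => z
  | _, z => z
  | o, b => b
  | a, o => a
  | w, w => v | w, v => o
  | v, w => o | v, v => w

/-- Inversion in the field with four elements. -/
def inv : Q4 → Q4
  | z => z | o => o | w => v | v => w

instance : Zero Q4 := ⟨z⟩
instance : One Q4 := ⟨o⟩
instance : Add Q4 := ⟨add⟩
instance : Mul Q4 := ⟨mul⟩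
instance : Neg Q4 := ⟨id⟩
instance : Inv Q4 := ⟨inv⟩

instance : Field Q4 where
  add_assoc := by decide
  zero_add := by decide
  add_zero := by decide
  add_comm := by decide
  neg_add_cancel := by decide
  mul_assoc := by decide
  one_mul := by decide
  mul_one := by decide
  mul_comm := by decide
  left_distrib := by decide
  right_distrib := by decide
  zero_mul := by decide
  mul_zero := by decide
  exists_pair_ne := ⟨z, o, by decide⟩
  mul_inv_cancel := by decide
  inv_zero := by decide
  nsmul := nsmulRec
  zsmul := zsmulRec
  nnqsmul := _
  qsmul := _

theorem card_eq : Fintype.card Q4 = 4 := rfl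

/-- The Frobenius automorphism. -/
def frob : Q4 ≃+* Q4 where
  toFun a := a * a
  invFun a := a * a
  left_inv := by decide
  right_inv := by decide
  map_mul' := by decide
  map_add' := by decide

/-- The coefficient of `1` in the basis `1, ω`. -/
def lo : Q4 → Bool
  | z => false | o => true | w => false | v => true

/-- The coefficient of `ω` in the basis `1, ω`. -/
def hi : Q4 → Bool
  | z => false | o => false | w => true | v => true

/-- The element with prescribed coordinates in the basis `1, ω`. -/
def ofBits (a b : Bool) : Q4 := bif a then bif b then v else o else bif b then w else z

theorem lo_add : ∀ a b : Q4, (a + b).lo = (a.lo ^^ b.lo) := by decide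
theorem hi_add : ∀ a b : Q4, (a + b).hi = (a.hi ^^ b.hi) := by decide
theorem eq_zero_iff : ∀ a : Q4, a = 0 ↔ a.lo = false ∧ a.hi = false := by decide
theorem ofBits_eq_zero_iff : ∀ a b : Bool, ofBits a b = 0 ↔ (a || b) = false := by decide

end Q4

theorem IsToeplitz.eq_sequence {m : ℕ} {F : Type*} {A : Matrix (Fin m) (Fin m) F}
    (hA : IsToeplitz A) (hm : 0 < m) :
    ∃ t : ℕ → F, ∀ i j : Fin m, A i j = t (j + (m - 1) - i) := by
  refine ⟨fun k => A ⟨m - 1 - k, by omega⟩ ⟨min (k - (m - 1)) (m - 1), by omega⟩, fun i j => ?_⟩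
  refine hA _ _ _ _ ?_
  have := i.2
  have := j.2
  simp only
  omega

theorem wt_eq_card {ι F : Type*} [Fintype ι] [Zero F] [DecidableEq F] (v : ι → F) :
    wt v = (Finset.univ.filter fun i => v i ≠ 0).card := by
  rw [wt, Nat.card_eq_fintype_card, Fintype.card_subtype]

theorem wt_elim {m : ℕ} {F : Type*} [Zero F] (x y : Fin m → F) :
    wt (Sum.elim x y) = wt x + wt y := by
  classical
  simp only [wt_eq_card, Finset.card_filter, Fintype.sum_sum_type, Sum.elim_inl, Sum.elim_inr]
  congr!

/-- The existence statement, phrased through the two halves of a codeword. -/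
def HasCode (m : ℕ) (F : Type*) [Field F] : Prop :=
  ∃ A : Matrix (Fin m) (Fin m) F, IsToeplitz A ∧
    ∀ x : Fin m → F, x ≠ 0 → 9 ≤ wt x + wt (Matrix.vecMul x A)

theorem hasCode_iff (m : ℕ) (F : Type*) [Field F] :
    HasCode m F ↔ ∃ A : Matrix (Fin m) (Fin m) F, IsToeplitz A ∧
      ∀ c ∈ DTcode A, c ≠ 0 → 9 ≤ wt c := by
  refine exists_congr fun A => and_congr_right fun _ => ⟨?_, fun h x hx => ?_⟩
  · rintro h c ⟨x, rfl⟩ hc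
    rw [wt_elim]
    refine h x fun hx => hc ?_
    subst hx
    ext (i | i) <;> simp
  · rw [← wt_elim]
    refine h _ ⟨x, rfl⟩ fun h0 => hx ?_
    ext i
    simpa using congrFun h0 (Sum.inl i)

theorem wt_map {ι F K : Type*} [Fintype ι] [Field F] [Field K] (e : F ≃+* K) (v : ι → F) :
    wt (fun i => e (v i)) = wt v := by
  classical
  simp [wt_eq_card]

theorem HasCode.map {m : ℕ} {F K : Type*} [Field F] [Field K] (e : F ≃+* K)
    (h : HasCode m F) : HasCode m K := by
  obtain ⟨A, hA, h⟩ := h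
  refine ⟨A.map e, fun i j i' j' hij => by simp [hA i j i' j' hij], fun x hx => ?_⟩
  have := h (fun i => e.symm (x i)) fun h0 => hx ?_
  · rw [wt_map, ← wt_map e] at this
    convert this using 3
    ext i
    simp [Matrix.vecMul, dotProduct]
  · ext i
    simpa using congrFun h0 i

theorem hasCode_iff_Q4 {m : ℕ} (F : Type*) [Field F] [Fintype F] (hF : Fintype.card F = 4) :
    HasCode m F ↔ HasCode m Q4 := by
  have e : F ≃+* Q4 := FiniteField.ringEquivOfCardEq (by rw [hF, Q4.card_eq])
  exact ⟨fun h => h.map e, fun h => h.map e.symm⟩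

open Finset in
/-- Bound on the number of zeros that a combination of shifts of the first `n` terms of `t` has in
a window of length `m`; the diagonals of a double Toeplitz code of minimum weight at least `9`
satisfy it. -/
def WindowBound (m n : ℕ) (t : ℕ → Q4) : Prop :=
  ∀ (x : ℕ → Q4) (s j₀ : ℕ), x 0 ≠ 0 → s < m → s ≤ j₀ →
    #{j ∈ range n | j₀ ≤ j ∧ j < j₀ + m ∧ ∑ i ∈ range (s + 1), x i * t (j - i) = 0} + 9 ≤
      m + #{i ∈ range (s + 1) | x i ≠ 0}

open Finset in
theorem HasCode.exists_windowBound {m : ℕ} (hm : 0 < m) (h : HasCode m Q4) :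
    ∃ t, WindowBound m (2 * m - 1) t := by
  obtain ⟨A, hA, h⟩ := h
  obtain ⟨t, ht⟩ := hA.eq_sequence hm
  refine ⟨t, fun x s j₀ hx hs hj => ?_⟩
  obtain ⟨J, hJ⟩ : ∃ J, J = min j₀ (m - 1) := ⟨_, rfl⟩
  obtain ⟨a, ha⟩ : ∃ a, a = m - 1 - J := ⟨_, rfl⟩
  let e : Fin (s + 1) ↪ Fin m :=
    ⟨fun i => ⟨a + i, by omega⟩, fun i j hij => by simpa [Fin.ext_iff] using hij⟩
  let X : Fin m → Q4 := fun r => if a ≤ r ∧ r ≤ a + s then x (r - a) else 0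
  have he (i : Fin (s + 1)) : (e i : ℕ) = a + i := rfl
  have hXe (i : Fin (s + 1)) : X (e i) = x i := by
    have := i.2
    simp only [X, he]
    rw [if_pos (by omega)]
    congr 1
    omega
  have hX (r : Fin m) (hr : X r ≠ 0) : ∃ i, e i = r := by
    simp only [X, ne_eq, ite_eq_right_iff, Classical.not_imp] at hr
    exact ⟨⟨r - a, by omega⟩, Fin.ext (by rw [he]; simp only; omega)⟩
  have key := h X fun h0 => hx (by simpa [hXe] using congrFun h0 (e 0))
  have hwt : wt X = #{i ∈ range (s + 1) | x i ≠ 0} := by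
    rw [wt_eq_card, card_filter, card_filter, sum_range (fun i => if x i ≠ 0 then 1 else 0)]
    have := sum_map univ e fun r => if X r ≠ 0 then 1 else 0
    simp only [hXe] at this
    rw [← this]
    symm
    refine sum_subset (subset_univ _) fun r _ hr => ?_
    rw [if_neg]
    intro h0
    obtain ⟨i, rfl⟩ := hX r h0
    exact hr (by simp)
  have hvec (c : Fin m) :
      Matrix.vecMul X A c = ∑ i ∈ range (s + 1), x i * t (c + J - i) := by
    rw [sum_range (fun i => x i * t (c + J - i))]
    have := sum_map univ e fun r => X r * A r c
    simp only [hXe] at this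
    rw [Matrix.vecMul, dotProduct, ← sum_subset (subset_univ (univ.map e)), this]
    · refine sum_congr rfl fun i _ => ?_
      have := i.2
      rw [ht]
      congr 2
      rw [he]
      omega
    · intro r _ hr
      by_cases h0 : X r = 0
      · simp [h0]
      · obtain ⟨i, rfl⟩ := hX r h0
        exact absurd (by simp) hr
  have hcard : #{j ∈ range (2 * m - 1) | j₀ ≤ j ∧ j < j₀ + m ∧
        ∑ i ∈ range (s + 1), x i * t (j - i) = 0} ≤
      #{c : Fin m | Matrix.vecMul X A c = 0} := by
    refine card_le_card_of_surjOn (fun c => c + J) fun j hj => ?_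
    simp only [coe_filter, mem_range, Set.mem_ofPred_eq] at hj
    refine ⟨⟨j - J, by omega⟩, ?_, by simp only; omega⟩
    simp only [coe_filter, mem_univ, true_and, Set.mem_ofPred_eq, hvec]
    rw [← hj.2.2.2]
    refine sum_congr rfl fun i _ => ?_
    congr 2
    omega
  have hsplit := card_filter_add_card_filter_not (s := (univ : Finset (Fin m)))
    (fun c => Matrix.vecMul X A c = 0)
  rw [card_univ, Fintype.card_fin] at hsplit
  rw [hwt, wt_eq_card (Matrix.vecMul X A)] at key
  simp only [ne_eq] at key ⊢
  omega

open Finset in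
theorem WindowBound.shift {m n : ℕ} {t : ℕ → Q4} (h : WindowBound m n t) (d : ℕ) :
    WindowBound m (n - d) fun k => t (k + d) := by
  intro x s j₀ hx hs hj
  refine le_trans (Nat.add_le_add_right ?_ 9) (h x s (j₀ + d) hx hs (by omega))
  refine card_le_card_of_injOn (· + d) (fun j hj' => ?_) fun _ _ _ _ => by simp
  simp only [coe_filter, mem_range, Set.mem_ofPred_eq] at hj' ⊢
  refine ⟨by omega, by omega, by omega, ?_⟩
  rw [← hj'.2.2.2]
  refine sum_congr rfl fun i hi => ?_
  rw [mem_range] at hi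
  congr 2
  omega

open Finset in
theorem WindowBound.mono {m n n' : ℕ} {t : ℕ → Q4} (h : WindowBound m n t) (hn : n' ≤ n) :
    WindowBound m n' t := fun x s j₀ hx hs hj =>
  le_trans (Nat.add_le_add_right (card_le_card
    (filter_subset_filter _ (range_mono hn))) 9) (h x s j₀ hx hs hj)

open Finset in
theorem WindowBound.scale {m n : ℕ} {t : ℕ → Q4} (h : WindowBound m n t) {a l : Q4}
    (ha : a ≠ 0) (hl : l ≠ 0) : WindowBound m n fun k => a * l ^ k * t k := by
  intro x s j₀ hx hs hj
  refine le_trans (Nat.add_le_add_right (card_le_card fun j hj' => ?_) 9)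
    ((h (fun i => x i / l ^ i) s j₀ (by simpa using hx) hs hj).trans_eq ?_)
  · simp only [mem_filter] at hj' ⊢
    refine ⟨hj'.1, hj'.2.1, hj'.2.2.1, ?_⟩
    have := hj'.2.2.2
    have heq : ∑ i ∈ range (s + 1), x i * (a * l ^ (j - i) * t (j - i)) =
        a * l ^ j * ∑ i ∈ range (s + 1), x i / l ^ i * t (j - i) := by
      rw [mul_sum]
      refine sum_congr rfl fun i hi => ?_
      rw [mem_range] at hi
      obtain ⟨k, rfl⟩ : ∃ k, j = i + k := ⟨j - i, by omega⟩
      rw [Nat.add_sub_cancel_left, pow_add]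
      field_simp
    rw [heq] at this
    simpa [ha, hl] using this
  · simp [hl]

open Finset in
theorem WindowBound.frob {m n : ℕ} {t : ℕ → Q4} (h : WindowBound m n t) :
    WindowBound m n fun k => Q4.frob (t k) := by
  intro x s j₀ hx hs hj
  refine le_trans (Nat.add_le_add_right (card_le_card fun j hj' => ?_) 9)
    ((h (fun i => Q4.frob.symm (x i)) s j₀ (by simpa using hx) hs hj).trans_eq ?_)
  · simp only [mem_filter] at hj' ⊢
    refine ⟨hj'.1, hj'.2.1, hj'.2.2.1, Q4.frob.injective ?_⟩
    simpa using hj'.2.2.2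
  · simp

/-- Up to the Frobenius automorphism, `ω` occurs before `ω²`. -/
def OmegaFirst (t : ℕ → Q4) : Prop := ∀ k, t k = Q4.v → ∃ i < k, t i = Q4.w

theorem omegaFirst_or (t : ℕ → Q4) : OmegaFirst t ∨ OmegaFirst fun k => Q4.frob (t k) := by
  have hv : ∀ a, Q4.frob a = Q4.v ↔ a = Q4.w := by decide
  have hw : ∀ a, Q4.frob a = Q4.w ↔ a = Q4.v := by decide
  simp only [OmegaFirst, hv, hw]
  by_contra! h
  obtain ⟨⟨k, hk, hk'⟩, l, hl, hl'⟩ := h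
  rcases lt_trichotomy k l with h | rfl | h
  · exact hl' k h hk
  · simp_all
  · exact hk' l h hl

/-- The symbols allowed in the successive positions of the initial segments to be searched. -/
def seeds : List (List (Q4 → Bool)) :=
  let nz : Q4 → Bool := fun s => s != .z
  let eq : Q4 → Q4 → Bool := fun s t => s == t
  [[eq .o, eq .o, nz, nz, nz, nz], [eq .z, eq .o, eq .o], [eq .z, eq .o, eq .z],
    [eq .z, eq .z, eq .o], [eq .z, eq .z, eq .z]]

theorem WindowBound.exists_seed {m n : ℕ} {t : ℕ → Q4} (h : WindowBound m n t) :
    ∃ t', WindowBound m (n - 5) t' ∧ OmegaFirst t' ∧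
      ∃ l ∈ seeds, ∀ k (hk : k < l.length), l[k] (t' k) = true := by
  have hfrob : ∀ l ∈ seeds, ∀ f ∈ l, ∀ a, f a = true → f (Q4.frob a) = true := by decide
  suffices ∃ t', WindowBound m (n - 5) t' ∧
      ∃ l ∈ seeds, ∀ k (hk : k < l.length), l[k] (t' k) = true by
    obtain ⟨t', h, l, hl, hk⟩ := this
    rcases omegaFirst_or t' with ht | ht
    · exact ⟨t', h, ht, l, hl, hk⟩
    · exact ⟨_, h.frob, ht, l, hl, fun k hk' =>
        hfrob l hl _ (List.getElem_mem hk') _ (hk k hk')⟩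
  have h01 : (0 : Q4) = .z ∧ (1 : Q4) = .o := ⟨rfl, rfl⟩
  by_cases h0 : ∀ i < 6, t i ≠ 0
  · refine ⟨_, (h.scale (a := (t 0)⁻¹) (l := t 0 / t 1) (by simp [h0]) (by simp [h0])).mono
      (by omega), _, .head _, fun k hk => ?_⟩
    have hk : k < 6 := hk
    have hk0 := h0 k hk
    have h00 := h0 0 (by decide)
    have h10 := h0 1 (by decide)
    interval_cases k <;> simp [← h01.1, ← h01.2, h0]
    field_simp
  push Not at h0
  obtain ⟨i, hi, hti⟩ := h0
  have hs := (h.shift i).mono (n' := n - 5) (by omega)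
  obtain ⟨u, hu⟩ : ∃ u, u = fun k => t (k + i) := ⟨_, rfl⟩
  have hu0 : u 0 = 0 := by simp [hu, hti]
  rw [← hu] at hs
  by_cases h1 : u 1 = 0 <;> by_cases h2 : u 2 = 0
  · refine ⟨_, hs, _, .tail _ (.tail _ (.tail _ (.tail _ (.head _)))), fun k hk => ?_⟩
    have hk : k < 3 := hk
    interval_cases k <;> simp [← h01.1, hu0, h1, h2]
  · refine ⟨_, hs.scale (a := (u 2)⁻¹) (l := 1) (by simp [h2]) one_ne_zero, _,
      .tail _ (.tail _ (.tail _ (.head _))), fun k hk => ?_⟩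
    have hk : k < 3 := hk
    interval_cases k <;> simp [← h01.1, ← h01.2, hu0, h1, h2]
  · refine ⟨_, hs.scale (a := (u 1)⁻¹) (l := 1) (by simp [h1]) one_ne_zero, _,
      .tail _ (.tail _ (.head _)), fun k hk => ?_⟩
    have hk : k < 3 := hk
    interval_cases k <;> simp [← h01.1, ← h01.2, hu0, h1, h2]
  · refine ⟨_, hs.scale (a := u 2 / u 1 ^ 2) (l := u 1 / u 2) (by simp [h1, h2])
      (by simp [h1, h2]), _, .tail _ (.head _), fun k hk => ?_⟩
    have hk : k < 3 := hk
    interval_cases k <;> simp [← h01.1, ← h01.2, hu0, h2] <;> field_simp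

/-- Lanes whose coefficient at lag `1` has a component along `1`. -/
def coeffLo1 : Nat :=
  nat_lit 4646927838984619358745790038171267177909915237526562229100542397262580308069631590902792806135681140937174135796229877885227323638927687636099987115199554842711823041269201253703822619870539216422726944880340782454925656225821215860755981943643556737867015261237686108519860960784724

/-- Lanes whose coefficient at lag `1` has a component along `ω`. -/
def coeffHi1 : Nat :=
  nat_lit 4646927838993072071243929931323973858384117149254647281591235093878666964243020550990698700931057053571457445460410334986572551314348647725054494103601469081075062672746607749817607839861154368487176942424746256846053241549657847555552478114419461018484693707905385812989172563018136

/-- Lanes whose coefficient at lag `2` has a component along `1`. -/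
def coeffLo2 : Nat :=
  nat_lit 4129594075675183157427089362021126289574496254599506713318770248852012303266349227678120482178977105892718829649677113741189737040895428999316370882265915861877442660183962556506234732150889093196172345420468723132578961165128443513270195825015793793929443134170068815707374911674880

/-- Lanes whose coefficient at lag `2` has a component along `ω`. -/
def coeffHi2 : Nat :=
  nat_lit 4574319591517125958996160524084939886978307306943747833457229261555766717584797257233381440090013547096652434086416542073405048774052964196847982110971076857281181893665404706857621882210211288183567727744781922470088510208270162477865192856435820093684939369272603956350218164464640

/-- Lanes whose coefficient at lag `3` has a component along `1`. -/
def coeffLo3 : Nat :=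
  nat_lit 8065613429053092104349783910197537083791113500214802800964273233608673046494525679215431955433519935184345945001851886045560901092127397069987047185127209473372425388148315605222254475272138964627297287096418035596988033997219514837271523294776880973852142153544661543236512251904

/-- Lanes whose coefficient at lag `3` has a component along `ω`. -/
def coeffHi3 : Nat :=
  nat_lit 8934217952181886638664376023603425692814771877161012333375807918089513993587327110559225514876027569693168535988699748470864108723858521488360033167287865885547442958194624072586392293347093315923092571395733297889873532445848905429040747947440122214565630935377221195706191052800

/-- Lanes whose coefficient at lag `4` has a component along `1`. -/
def coeffLo4 : Nat :=
  nat_lit 15753151228619320516308171699604564616779518555107036720653379018006018401172801295845141855600478279415096373156026878995012966427300132009125461489073400831834968378031893958332638465709829805817687265705765698773296267133217031789570907436533410738959289511987143210658955264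

/-- Lanes whose coefficient at lag `4` has a component along `ω`. -/
def coeffHi4 : Nat :=
  nat_lit 17449644437855247341141359421100440806278851322580102213646819835329743459760378311474697495141470607792321003039158034706233018488344880271929083833668167248667068985392767091586653108012780902023686177187967829024455667531496205937872944115939689329754006064810068440189501440

/-- Lanes whose coefficient at lag `5` has a component along `1`. -/
def coeffLo5 : Nat :=
  nat_lit 30767873493397110383414397850790165267147497177943431095026130894543004691963126104317455851630170866829772920739550343602127860268424502402087982909316424041259567145882572358792583403743458264993927437262778075086513299845690308012312433289285884461004845523848612823433216

/-- Lanes whose coefficient at lag `5` has a component along `ω`. -/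
def coeffHi5 : Nat :=
  nat_lit 34081336792686029963166717619336798449763381489414262136028944990878405197251462761705490132497916856414870842054499575151209764746199156398161094800145103505027896197242781470003429737821178579409020211626239140040212194692980025043566426778160497570028858975361894738558976

/-- Lanes whose coefficient at lag `6` has a component along `1`. -/
def coeffLo6 : Nat :=
  nat_lit 3319234170709337193745675219084599464578705807275434060392347900258796109733045476663322130571771352448747644237291507549638873747384044488003932767796631080579648903195394216375611851639333507930784574318246841854518768823660909514343177580898174815884566587859166175052607772426240

/-- Lanes whose coefficient at lag `6` has a component along `ω`. -/
def coeffHi6 : Nat :=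
  nat_lit 3983081004851204632494810262901519357494446968730520872470817480310555331679654571995986556686125622938497173084749809059566648496860853385604719321355957296695578683834473059650734221967200209516941489181896210225422522588393091417211813097077809779061479905430999410063129326911488

/-- The number of lanes whose window starts at most at the given position. -/
def laneBounds : List Nat := [1, 5, 21, 84, 255, 621, 939]

/-- Lanes whose window of length `8` contains the successive positions. -/
def windows8 : List Nat :=
  [1,
   31,
   2097151,
   19342813113834066795298815,
   57896044618658097711785492504343953926634992332820282019728792003956564819967,
   8702164874309912144930213176155645990168053640839691029699692760275411924760203145038438437113516616399082774302662672635438355868101955410485575332111767174247731541367082500615833649151,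
   4646927838993072071243945306718439250410188130185607684549287060362314553626263667328650982800488595593121011844353040782670578892327830336846345565944983205571783876398312106070895030732180427719497486819848241268961714708993375275490934188589556509412640954544199727574266715045887,
   4646927838993072071243945306718439250410188130185607684549287060362314553626263667328650982800488595593121011844353040782670578892327830336846345565944983205571783876398312106070895030732180427719497486819848241268961714708993375275490934188589556509412640954544199727574266715045887,
   4646927838993072071243945306718439250410188130185607684549287060362314553626263667328650982800488595593121011844353040782670578892327830336846345565944983205571783876398312106070895030732180427719497486819848241268961714708993375275490934188589556509412640954544199727574266715045886,
   4646927838993072071243945306718439250410188130185607684549287060362314553626263667328650982800488595593121011844353040782670578892327830336846345565944983205571783876398312106070895030732180427719497486819848241268961714708993375275490934188589556509412640954544199727574266715045856]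

/-- Binary digit `0` of the offset of the zero counters for windows of length `8`. -/
def offset8_0 : Nat :=
  nat_lit 59168987487302135352719995866904163975283648419121982875050251720275009023006011774585553382497254070376216611367479577979837906075861503122977132392061260136113400224133955406227731162882112190092200475899667595978329120642404058908546360640930565180452262351947251576867

/-- Binary digit `1` of the offset of the zero counters for windows of length `8`. -/
def offset8_1 : Nat :=
  nat_lit 60915154120945013153593801724971584259573811483639717096649648047241365482525607142756669120538393763876962139515856694617207131922544552056951848463060203827068925183207979647278574997503

/-- Binary digit `2` of the offset of the zero counters for windows of length `8`. -/
def offset8_2 : Nat :=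
  nat_lit 4646927838993072071243945306718439250410188130185607684549287060362314553626263667328650982800488595593120236216213958473178696829999432900848583686056231407142623468407139293273865488670118190187554076800075112867604393960240856214935317423157741912707576304649632159265639804960767

/-- Lanes whose window of length `9` contains the successive positions. -/
def windows9 : List Nat :=
  [1,
   31,
   2097151,
   19342813113834066795298815,
   57896044618658097711785492504343953926634992332820282019728792003956564819967,
   8702164874309912144930213176155645990168053640839691029699692760275411924760203145038438437113516616399082774302662672635438355868101955410485575332111767174247731541367082500615833649151,
   4646927838993072071243945306718439250410188130185607684549287060362314553626263667328650982800488595593121011844353040782670578892327830336846345565944983205571783876398312106070895030732180427719497486819848241268961714708993375275490934188589556509412640954544199727574266715045887,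
   4646927838993072071243945306718439250410188130185607684549287060362314553626263667328650982800488595593121011844353040782670578892327830336846345565944983205571783876398312106070895030732180427719497486819848241268961714708993375275490934188589556509412640954544199727574266715045887,
   4646927838993072071243945306718439250410188130185607684549287060362314553626263667328650982800488595593121011844353040782670578892327830336846345565944983205571783876398312106070895030732180427719497486819848241268961714708993375275490934188589556509412640954544199727574266715045887,
   4646927838993072071243945306718439250410188130185607684549287060362314553626263667328650982800488595593121011844353040782670578892327830336846345565944983205571783876398312106070895030732180427719497486819848241268961714708993375275490934188589556509412640954544199727574266715045886,
   4646927838993072071243945306718439250410188130185607684549287060362314553626263667328650982800488595593121011844353040782670578892327830336846345565944983205571783876398312106070895030732180427719497486819848241268961714708993375275490934188589556509412640954544199727574266715045856,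
   4646927838993072071243945306718439250410188130185607684549287060362314553626263667328650982800488595593121011844353040782670578892327830336846345565944983205571783876398312106070895030732180427719497486819848241268961714708993375275490934188589556509412640954544199727574266712948736]

/-- Binary digit `0` of the offset of the zero counters for windows of length `9`. -/
def offset9_0 : Nat :=
  nat_lit 4646927838933903083756643171365719254543283966210324036130165077487264301905988658305644971025903042210623757773976824171303099314347992430770484062822006073179722616262198705846761075325952696556615374629756040793062047113015046154848530129681010148771710389363747465222319463469020

/-- Binary digit `1` of the offset of the zero counters for windows of length `9`. -/
def offset9_1 : Nat :=
  nat_lit 4646927838933903083756643171365719254543283966210324036130165077487264301905988658305644971025842127056504364017101394988561891854745213491282368105502860021990802066762018724298063490329538777856625232529786440901159481478597539723902811812081579138354770763969674622192294708641827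

/-- Binary digit `2` of the offset of the zero counters for windows of length `9`. -/
def offset9_2 : Nat :=
  nat_lit 59168987487302135352719995866904163975283648419121982875050251720275009023006011774646468536616647827251645794108687037582616845563977460442123183580981809636293381772831540402641649862872254290061800367802233230395835551588122376507977371057870190574525105381972006404095

/-- Lanes whose window of length `10` contains the successive positions. -/
def windows10 : List Nat :=
  [1,
   31,
   2097151,
   19342813113834066795298815,
   57896044618658097711785492504343953926634992332820282019728792003956564819967,
   8702164874309912144930213176155645990168053640839691029699692760275411924760203145038438437113516616399082774302662672635438355868101955410485575332111767174247731541367082500615833649151,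
   4646927838993072071243945306718439250410188130185607684549287060362314553626263667328650982800488595593121011844353040782670578892327830336846345565944983205571783876398312106070895030732180427719497486819848241268961714708993375275490934188589556509412640954544199727574266715045887,
   4646927838993072071243945306718439250410188130185607684549287060362314553626263667328650982800488595593121011844353040782670578892327830336846345565944983205571783876398312106070895030732180427719497486819848241268961714708993375275490934188589556509412640954544199727574266715045887,
   4646927838993072071243945306718439250410188130185607684549287060362314553626263667328650982800488595593121011844353040782670578892327830336846345565944983205571783876398312106070895030732180427719497486819848241268961714708993375275490934188589556509412640954544199727574266715045887,
   4646927838993072071243945306718439250410188130185607684549287060362314553626263667328650982800488595593121011844353040782670578892327830336846345565944983205571783876398312106070895030732180427719497486819848241268961714708993375275490934188589556509412640954544199727574266715045887,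
   4646927838993072071243945306718439250410188130185607684549287060362314553626263667328650982800488595593121011844353040782670578892327830336846345565944983205571783876398312106070895030732180427719497486819848241268961714708993375275490934188589556509412640954544199727574266715045886,
   4646927838993072071243945306718439250410188130185607684549287060362314553626263667328650982800488595593121011844353040782670578892327830336846345565944983205571783876398312106070895030732180427719497486819848241268961714708993375275490934188589556509412640954544199727574266715045856,
   4646927838993072071243945306718439250410188130185607684549287060362314553626263667328650982800488595593121011844353040782670578892327830336846345565944983205571783876398312106070895030732180427719497486819848241268961714708993375275490934188589556509412640954544199727574266712948736,
   4646927838993072071243945306718439250410188130185607684549287060362314553626263667328650982800488595593121011844353040782670578892327830336846345565944983205571783876398312106070895030732180427719497486819848241268961714708993375275490934188589556509412640935201386613740199919747072]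

/-- Binary digit `0` of the offset of the zero counters for windows of length `10`. -/
def offset10_0 : Nat :=
  nat_lit 59168987487302135352719995866904163975283648419121982875050251720275009023006011774585553382497254070376216611367479577979837906075861503122977132392061260136113400224133955406227731162882112190092200475899667595978329120642404058908546360640930565180452262351947251576867

/-- Binary digit `1` of the offset of the zero counters for windows of length `10`. -/
def offset10_1 : Nat :=
  nat_lit 4646927838993072071243945306718439250410188130185607684549287060362314553626263667328650982800427680439000066831199446980945607308068256525362705848848333557524542510915786498928138361611642033955620524680332384574344507577070830723433982340126496305585572029360991747926988140048384

/-- Binary digit `2` of the offset of the zero counters for windows of length `10`. -/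
def offset10_2 : Nat :=
  nat_lit 60915154120169385014511492233089521931176375485877837207897849618080957491352794345727127058476156231933552119742728293259886383170025491501335083031245607122004275288640411338651664912383

/-- Lanes whose window of length `11` contains the successive positions. -/
def windows11 : List Nat :=
  [1,
   31,
   2097151,
   19342813113834066795298815,
   57896044618658097711785492504343953926634992332820282019728792003956564819967,
   8702164874309912144930213176155645990168053640839691029699692760275411924760203145038438437113516616399082774302662672635438355868101955410485575332111767174247731541367082500615833649151,
   4646927838993072071243945306718439250410188130185607684549287060362314553626263667328650982800488595593121011844353040782670578892327830336846345565944983205571783876398312106070895030732180427719497486819848241268961714708993375275490934188589556509412640954544199727574266715045887,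
   4646927838993072071243945306718439250410188130185607684549287060362314553626263667328650982800488595593121011844353040782670578892327830336846345565944983205571783876398312106070895030732180427719497486819848241268961714708993375275490934188589556509412640954544199727574266715045887,
   4646927838993072071243945306718439250410188130185607684549287060362314553626263667328650982800488595593121011844353040782670578892327830336846345565944983205571783876398312106070895030732180427719497486819848241268961714708993375275490934188589556509412640954544199727574266715045887,
   4646927838993072071243945306718439250410188130185607684549287060362314553626263667328650982800488595593121011844353040782670578892327830336846345565944983205571783876398312106070895030732180427719497486819848241268961714708993375275490934188589556509412640954544199727574266715045887,
   4646927838993072071243945306718439250410188130185607684549287060362314553626263667328650982800488595593121011844353040782670578892327830336846345565944983205571783876398312106070895030732180427719497486819848241268961714708993375275490934188589556509412640954544199727574266715045887,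
   4646927838993072071243945306718439250410188130185607684549287060362314553626263667328650982800488595593121011844353040782670578892327830336846345565944983205571783876398312106070895030732180427719497486819848241268961714708993375275490934188589556509412640954544199727574266715045886,
   4646927838993072071243945306718439250410188130185607684549287060362314553626263667328650982800488595593121011844353040782670578892327830336846345565944983205571783876398312106070895030732180427719497486819848241268961714708993375275490934188589556509412640954544199727574266715045856,
   4646927838993072071243945306718439250410188130185607684549287060362314553626263667328650982800488595593121011844353040782670578892327830336846345565944983205571783876398312106070895030732180427719497486819848241268961714708993375275490934188589556509412640954544199727574266712948736,
   4646927838993072071243945306718439250410188130185607684549287060362314553626263667328650982800488595593121011844353040782670578892327830336846345565944983205571783876398312106070895030732180427719497486819848241268961714708993375275490934188589556509412640935201386613740199919747072,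
   4646927838993072071243945306718439250410188130185607684549287060362314553626263667328650982800488595593121011844353040782670578892327830336846345565944983205571783876398312106070895030732180427719497486819790345224343056611281589782986590234662921517079820672524470935570310150225920]

/-- Binary digit `0` of the offset of the zero counters for windows of length `11`. -/
def offset11_0 : Nat :=
  nat_lit 4646927838933903083756643171365719254543283966210324036130165077487264301905988658305644971025903042210623757773976824171303099314347992430770484062822006073179722616262198705846761075325952696556615374629756040793062047113015046154848530129681010148771710389363747465222319463469020

/-- Binary digit `1` of the offset of the zero counters for windows of length `11`. -/
def offset11_1 : Nat :=
  nat_lit 59168987487302135352719995866904163975283648419121982875050251720275009023006011774646468536616647827251645794108687037582616845563977460442123183580981809636293381772831540402641649862872254290061800367802233230395835551588122376507977371057870190574525105381972006404060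

/-- Binary digit `2` of the offset of the zero counters for windows of length `11`. -/
def offset11_2 : Nat :=
  nat_lit 35

/-- Lanewise coordinate along `1` of the product of `s` with the coefficients given by `a, b`. -/
noncomputable def mulLo (a b : Nat) (s : Q4) : Nat :=
  Q4.rec (motive := fun _ => Nat) 0 a b (Nat.xor a b) s

/-- Lanewise coordinate along `ω` of the product of `s` with the coefficients given by `a, b`. -/
noncomputable def mulHi (a b : Nat) (s : Q4) : Nat :=
  Q4.rec (motive := fun _ => Nat) 0 b (Nat.xor a b) a s

/-- Conjunction, evaluated lazily from the left. -/
noncomputable def andThen (x y : Bool) : Bool := Bool.rec (motive := fun _ => Bool) false y x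

/-- Lanewise coordinate along `1` of the contribution of the last three symbols. -/
noncomputable def lo123 (s₁ s₂ s₃ : Q4) : Nat :=
  Nat.xor (mulLo coeffLo1 coeffHi1 s₁)
    (Nat.xor (mulLo coeffLo2 coeffHi2 s₂) (mulLo coeffLo3 coeffHi3 s₃))

/-- Lanewise coordinate along `1` of the contribution of the three symbols before those. -/
noncomputable def lo456 (s₁ s₂ s₃ : Q4) : Nat :=
  Nat.xor (mulLo coeffLo4 coeffHi4 s₁)
    (Nat.xor (mulLo coeffLo5 coeffHi5 s₂) (mulLo coeffLo6 coeffHi6 s₃))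

/-- Lanewise coordinate along `ω` of the contribution of the last three symbols. -/
noncomputable def hi123 (s₁ s₂ s₃ : Q4) : Nat :=
  Nat.xor (mulHi coeffLo1 coeffHi1 s₁)
    (Nat.xor (mulHi coeffLo2 coeffHi2 s₂) (mulHi coeffLo3 coeffHi3 s₃))

/-- Lanewise coordinate along `ω` of the contribution of the three symbols before those. -/
noncomputable def hi456 (s₁ s₂ s₃ : Q4) : Nat :=
  Nat.xor (mulHi coeffLo4 coeffHi4 s₁)
    (Nat.xor (mulHi coeffLo5 coeffHi5 s₂) (mulHi coeffLo6 coeffHi6 s₃))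

/-- Add the zeros in the lanes `d` to the counters `c₀, c₁, c₂`, and continue with `k` unless the
symbol is not allowed or a counter overflows. -/
noncomputable def extend (allowed : Bool) (d c₀ c₁ c₂ : Nat) (k : Nat → Nat → Nat → Bool) : Bool :=
  Bool.rec (motive := fun _ => Bool) true
    ((fun e f => Bool.rec (motive := fun _ => Bool) true
      (k (Nat.xor c₀ d) (Nat.xor c₁ e) (Nat.xor c₂ f))
      (Nat.beq (Nat.land c₂ f) 0)) (Nat.land c₀ d) (Nat.land c₁ (Nat.land c₀ d))) allowed

/-- Exhaustive search for sequences in which no counter overflows; the value is `true` if there are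
none. The flag `fr` says that `ω` has not occurred yet, `s₁, …, s₆` are the previous symbols. -/
noncomputable def search (levels : List (Nat × (Q4 → Bool))) :
    Bool → Q4 → Q4 → Q4 → Q4 → Q4 → Q4 → Nat → Nat → Nat → Bool :=
  List.rec (motive := fun _ => Bool → Q4 → Q4 → Q4 → Q4 → Q4 → Q4 → Nat → Nat → Nat → Bool)
    (fun _ _ _ _ _ _ _ _ _ _ => false)
    (fun lv _ ih fr s₁ s₂ s₃ s₄ s₅ s₆ c₀ c₁ c₂ =>
      (fun a₁ hi => (fun a₀ => (fun z₂ z₃ =>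
        andThen (extend (lv.2 .z) (Nat.xor a₀ z₂) c₀ c₁ c₂ (ih fr .z s₁ s₂ s₃ s₄ s₅))
          (andThen (extend (lv.2 .o) (Nat.xor a₁ z₃) c₀ c₁ c₂ (ih fr .o s₁ s₂ s₃ s₄ s₅))
            (andThen (extend (lv.2 .w) z₂ c₀ c₁ c₂ (ih false .w s₁ s₂ s₃ s₄ s₅))
              (Bool.rec (motive := fun _ => Bool)
                (extend (lv.2 .v) z₃ c₀ c₁ c₂ (ih false .v s₁ s₂ s₃ s₄ s₅)) true fr))))
        (Nat.land a₀ hi) (Nat.land a₁ hi)) (Nat.xor lv.1 a₁))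
      (Nat.land lv.1 (Nat.xor (lo123 s₁ s₂ s₃) (lo456 s₄ s₅ s₆)))
      (Nat.xor (hi123 s₁ s₂ s₃) (hi456 s₄ s₅ s₆))) levels

/-- The search over all sequences that start as prescribed by `seed`. -/
noncomputable def searchSeed (act : List Nat) (c₀ c₁ c₂ : Nat) (seed : List (Q4 → Bool)) : Bool :=
  search (act.zip (seed ++ List.replicate (act.length - seed.length) fun _ => true))
    true .z .z .z .z .z .z c₀ c₁ c₂

theorem testBit_mulLo (a b : Nat) (s : Q4) (l : Nat) :
    (mulLo a b s).testBit l = (Q4.ofBits (a.testBit l) (b.testBit l) * s).lo := by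
  have h : (Nat.xor a b).testBit l = (a.testBit l ^^ b.testBit l) := Nat.testBit_xor ..
  cases s <;> simp only [mulLo, h, Nat.zero_testBit] <;>
    generalize a.testBit l = p <;> generalize b.testBit l = q <;> revert p q <;> decide

theorem testBit_mulHi (a b : Nat) (s : Q4) (l : Nat) :
    (mulHi a b s).testBit l = (Q4.ofBits (a.testBit l) (b.testBit l) * s).hi := by
  have h : (Nat.xor a b).testBit l = (a.testBit l ^^ b.testBit l) := Nat.testBit_xor ..
  cases s <;> simp only [mulHi, h, Nat.zero_testBit] <;>
    generalize a.testBit l = p <;> generalize b.testBit l = q <;> revert p q <;> decide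

theorem andThen_eq_true {x y : Bool} : andThen x y = true ↔ x = true ∧ y = true := by
  cases x <;> cases y <;> decide

/-- The coefficients of the linear combination belonging to lane `l`. -/
def coeff (l : Nat) : ℕ → Q4
  | 0 => 1
  | 1 => Q4.ofBits (coeffLo1.testBit l) (coeffHi1.testBit l)
  | 2 => Q4.ofBits (coeffLo2.testBit l) (coeffHi2.testBit l)
  | 3 => Q4.ofBits (coeffLo3.testBit l) (coeffHi3.testBit l)
  | 4 => Q4.ofBits (coeffLo4.testBit l) (coeffHi4.testBit l)
  | 5 => Q4.ofBits (coeffLo5.testBit l) (coeffHi5.testBit l)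
  | 6 => Q4.ofBits (coeffLo6.testBit l) (coeffHi6.testBit l)
  | _ => 0

/-- The sequence `t` read backwards from position `j`, continued by zeros. -/
def back (t : ℕ → Q4) (j i : ℕ) : Q4 := if i ≤ j then t (j - i) else 0

/-- The value at position `j` of the linear combination belonging to lane `l`. -/
def laneVal (t : ℕ → Q4) (l j : ℕ) : Q4 := ∑ i ∈ Finset.range 7, coeff l i * back t j i

theorem testBit_lo (t : ℕ → Q4) (l j : ℕ) :
    (t j).lo = (Nat.xor (lo123 (back t j 1) (back t j 2) (back t j 3))
      (lo456 (back t j 4) (back t j 5) (back t j 6))).testBit l ↔ (laneVal t l j).lo = false := by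
  have hx (a b : Nat) : (Nat.xor a b).testBit l = (a.testBit l ^^ b.testBit l) :=
    Nat.testBit_xor ..
  simp only [laneVal, Finset.sum_range_succ, Finset.sum_range_zero, zero_add, Q4.lo_add, lo123,
    lo456, hx, testBit_mulLo, coeff, one_mul]
  simp only [back, zero_le, if_true, Nat.sub_zero]
  grind

theorem testBit_hi (t : ℕ → Q4) (l j : ℕ) :
    (t j).hi = (Nat.xor (hi123 (back t j 1) (back t j 2) (back t j 3))
      (hi456 (back t j 4) (back t j 5) (back t j 6))).testBit l ↔ (laneVal t l j).hi = false := by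
  have hx (a b : Nat) : (Nat.xor a b).testBit l = (a.testBit l ^^ b.testBit l) :=
    Nat.testBit_xor ..
  simp only [laneVal, Finset.sum_range_succ, Finset.sum_range_zero, zero_add, Q4.hi_add, hi123,
    hi456, hx, testBit_mulHi, coeff, one_mul]
  simp only [back, zero_le, if_true, Nat.sub_zero]
  grind

/-- The value of the bit-sliced counter `c₀, c₁, c₂` in lane `l`. -/
def counter (c₀ c₁ c₂ l : Nat) : ℕ :=
  (c₀.testBit l).toNat + 2 * (c₁.testBit l).toNat + 4 * (c₂.testBit l).toNat

/-- The number of zeros in the window of lane `l` before position `j`. -/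
def zeroCount (act : ℕ → Nat) (t : ℕ → Q4) (l j : ℕ) : ℕ :=
  ((Finset.range j).filter fun k => (act k).testBit l = true ∧ laneVal t l k = 0).card

theorem zeroCount_succ (act : ℕ → Nat) (t : ℕ → Q4) (l j : ℕ) :
    zeroCount act t l (j + 1) =
      zeroCount act t l j + if (act j).testBit l = true ∧ laneVal t l j = 0 then 1 else 0 := by
  rw [zeroCount, zeroCount, Finset.range_add_one, Finset.filter_insert]
  split_ifs
  · rw [Finset.card_insert_of_notMem (by simp)]
  · rfl

theorem extend_sound {d c₀ c₁ c₂ : Nat} {k : Nat → Nat → Nat → Bool} {f : ℕ → ℕ}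
    (h : extend true d c₀ c₁ c₂ k = true)
    (hf : ∀ l, f l = counter c₀ c₁ c₂ l + if d.testBit l then 1 else 0) (hb : ∀ l, f l ≤ 7) :
    ∃ c₀' c₁' c₂', (∀ l, f l = counter c₀' c₁' c₂' l) ∧ k c₀' c₁' c₂' = true := by
  have hx (a b l : Nat) : (Nat.xor a b).testBit l = (a.testBit l ^^ b.testBit l) :=
    Nat.testBit_xor ..
  have ha (a b l : Nat) : (Nat.land a b).testBit l = (a.testBit l && b.testBit l) :=
    Nat.testBit_and ..
  have h0 : Nat.beq (Nat.land c₂ (Nat.land c₁ (Nat.land c₀ d))) 0 = true := by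
    rw [Nat.beq_eq]
    refine Nat.eq_of_testBit_eq fun l => ?_
    have := hb l
    rw [hf, counter] at this
    rw [ha, ha, ha, Nat.zero_testBit]
    revert this
    generalize c₀.testBit l = x, c₁.testBit l = y, c₂.testBit l = z, d.testBit l = w
    revert x y z w
    decide
  refine ⟨Nat.xor c₀ d, Nat.xor c₁ (Nat.land c₀ d), Nat.xor c₂ (Nat.land c₁ (Nat.land c₀ d)),
    fun l => ?_, ?_⟩
  · rw [hf, counter, counter, hx, hx, hx, ha, ha, ha]
    have := hb l
    rw [hf, counter] at this
    revert this
    generalize c₀.testBit l = x, c₁.testBit l = y, c₂.testBit l = z, d.testBit l = w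
    revert x y z w
    decide
  · simpa only [extend, h0] using h

theorem search_step {lv : Nat × (Q4 → Bool)} {ls : List (Nat × (Q4 → Bool))} {fr : Bool}
    {s₁ s₂ s₃ s₄ s₅ s₆ : Q4} {c₀ c₁ c₂ : Nat}
    (h : search (lv :: ls) fr s₁ s₂ s₃ s₄ s₅ s₆ c₀ c₁ c₂ = true) (s : Q4) (hs : lv.2 s = true)
    (hfr : fr = true → s ≠ .v) :
    ∃ d, extend true d c₀ c₁ c₂ (search ls (fr && !s.hi) s s₁ s₂ s₃ s₄ s₅) = true ∧
      ∀ l, d.testBit l = (lv.1.testBit l &&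
        (s.lo == (Nat.xor (lo123 s₁ s₂ s₃) (lo456 s₄ s₅ s₆)).testBit l) &&
        (s.hi == (Nat.xor (hi123 s₁ s₂ s₃) (hi456 s₄ s₅ s₆)).testBit l)) := by
  have hx (a b l : Nat) : (Nat.xor a b).testBit l = (a.testBit l ^^ b.testBit l) :=
    Nat.testBit_xor ..
  have ha (a b l : Nat) : (Nat.land a b).testBit l = (a.testBit l && b.testBit l) :=
    Nat.testBit_and ..
  change andThen _ (andThen _ (andThen _ _)) = true at h
  simp only [andThen_eq_true] at h
  obtain ⟨hz, ho, hw, hv⟩ := h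
  cases s
  · rw [hs] at hz
    rw [show (fr && !Q4.z.hi) = fr by simp [Q4.hi]]
    refine ⟨_, hz, fun l => ?_⟩
    simp only [hx, ha, Q4.lo, Q4.hi]
    grind
  · rw [hs] at ho
    rw [show (fr && !Q4.o.hi) = fr by simp [Q4.hi]]
    refine ⟨_, ho, fun l => ?_⟩
    simp only [hx, ha, Q4.lo, Q4.hi]
    grind
  · rw [hs] at hw
    rw [show (fr && !Q4.w.hi) = false by simp [Q4.hi]]
    refine ⟨_, hw, fun l => ?_⟩
    simp only [hx, ha, Q4.lo, Q4.hi]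
    grind
  · cases fr
    · change extend (lv.2 .v) _ _ _ _ _ = true at hv
      rw [hs] at hv
      rw [show (false && !Q4.v.hi) = false by simp [Q4.hi]]
      refine ⟨_, hv, fun l => ?_⟩
      simp only [hx, ha, Q4.lo, Q4.hi]
      grind
    · exact absurd rfl (hfr rfl)

theorem search_sound {act : ℕ → Nat} {t : ℕ → Q4} {b : ℕ → ℕ} (ht : OmegaFirst t)
    (ls : List (Nat × (Q4 → Bool))) :
    ∀ (j : ℕ) (fr : Bool) (c₀ c₁ c₂ : Nat),
      search ls fr (back t j 1) (back t j 2) (back t j 3) (back t j 4) (back t j 5) (back t j 6)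
        c₀ c₁ c₂ = true →
      (∀ k (hk : k < ls.length), ls[k].1 = act (j + k) ∧ ls[k].2 (t (j + k)) = true) →
      (∀ l, b l + zeroCount act t l j = counter c₀ c₁ c₂ l) →
      (∀ l k, k ≤ j + ls.length → b l + zeroCount act t l k ≤ 7) →
      (fr = true → ∀ k < j, t k ≠ .w) → False := by
  induction ls with
  | nil => intro j fr c₀ c₁ c₂ h; exact absurd h (by simp [search])
  | cons lv ls ih =>
    intro j fr c₀ c₁ c₂ h hconf hcount hbound hfr
    obtain ⟨hact, hlv⟩ := hconf 0 (by simp)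
    simp only [List.getElem_cons_zero, Nat.add_zero] at hact hlv
    obtain ⟨d, hd, hdl⟩ := search_step h (t j) hlv fun hf hv => by
      obtain ⟨i, hi, hiw⟩ := ht j hv
      exact hfr hf i hi hiw
    obtain ⟨c₀', c₁', c₂', hc, hk⟩ := extend_sound (f := fun l => b l + zeroCount act t l (j + 1))
      hd (fun l => by
        rw [zeroCount_succ, ← add_assoc, hcount, hdl, hact]
        congr 1
        refine if_congr ?_ rfl rfl
        rw [Q4.eq_zero_iff, ← testBit_lo, ← testBit_hi]
        simp only [Bool.and_eq_true, beq_iff_eq, and_assoc])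
      fun l => hbound l _ (by simp)
    refine ih (j + 1) (fr && !(t j).hi) c₀' c₁' c₂' ?_ (fun k hk => ?_) hc
      (fun l k hk => hbound l k (by simp; omega)) ?_
    · convert hk using 1
      simp [back]
    · have := hconf (k + 1) (by simpa using hk)
      simpa [add_assoc, add_comm 1] using this
    · intro hf k hk'
      simp only [Bool.and_eq_true, Bool.not_eq_true'] at hf
      rcases Nat.lt_succ_iff_lt_or_eq.mp hk' with h' | rfl
      · exact hfr hf.1 k h'
      · intro hw
        simp [hw, Q4.hi] at hf

/-- The lanes whose coefficient at lag `i` does not vanish. -/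
def support : ℕ → Nat
  | 1 => Nat.lor coeffLo1 coeffHi1
  | 2 => Nat.lor coeffLo2 coeffHi2
  | 3 => Nat.lor coeffLo3 coeffHi3
  | 4 => Nat.lor coeffLo4 coeffHi4
  | 5 => Nat.lor coeffLo5 coeffHi5
  | 6 => Nat.lor coeffLo6 coeffHi6
  | _ => 0

theorem testBit_support (l : Nat) {i : ℕ} (hi : 0 < i) :
    (support i).testBit l = true ↔ coeff l i ≠ 0 := by
  have h (a b : Nat) : (Nat.lor a b).testBit l = true ↔
      Q4.ofBits (a.testBit l) (b.testBit l) ≠ 0 := by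
    rw [ne_eq, Q4.ofBits_eq_zero_iff, Bool.not_eq_false]
    exact iff_of_eq (congrArg (· = true) (Nat.testBit_or ..))
  unfold support coeff
  split <;> first | exact h _ _ | (try split) <;> simp_all

/-- The number of lanes whose window starts at position at most `j`. -/
def laneBound (j : ℕ) : ℕ := laneBounds.getD j 939

theorem laneBound_mono : Monotone laneBound := by
  refine monotone_nat_of_le_succ fun j => ?_
  by_cases hj : j < 7
  · interval_cases j <;> decide
  · rw [laneBound, laneBound, List.getD_eq_default _ _ (by simpa [laneBounds] using hj),
      List.getD_eq_default _ _ (by simp [laneBounds]; omega)]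

theorem support_laneBound :
    ∀ k < 6, Nat.land (support (k + 1)) (2 ^ laneBound k - 1) = 0 := by
  decide +kernel

theorem coeff_eq_zero_of_lt {l k i : ℕ} (hl : l < laneBound k) (hk : k < i) (hi : i < 7) :
    coeff l i = 0 := by
  obtain ⟨i, rfl⟩ : ∃ i', i = i' + 1 := ⟨i - 1, by omega⟩
  by_contra h
  rw [← ne_eq, ← testBit_support l (by omega)] at h
  have h0 : (Nat.land (support (i + 1)) (2 ^ laneBound i - 1)).testBit l = false := by
    rw [support_laneBound i (by omega), Nat.zero_testBit]
  have h1 : l < laneBound i := hl.trans_le (laneBound_mono (by omega))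
  have h2 := (Nat.testBit_and (support (i + 1)) (2 ^ laneBound i - 1) l).symm.trans h0
  rw [h, Nat.testBit_two_pow_sub_one] at h2
  simp [h1] at h2

/-- The counter in lane `l` starts high enough to overflow exactly when there are more zeros than a
code of length `2 * m` and minimum weight `9` can have. -/
def offsetValid (m c₀ c₁ c₂ l : Nat) : Bool :=
  let bit (a : Nat) : Nat := Nat.land 1 (Nat.shiftRight a l)
  Nat.ble (Nat.add (Nat.add (Nat.add (bit c₀) (Nat.mul 2 (bit c₁))) (Nat.mul 4 (bit c₂)))
    (Nat.add m (Nat.add 1 (Nat.add (bit (support 1)) (Nat.add (bit (support 2))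
      (Nat.add (bit (support 3)) (Nat.add (bit (support 4)) (Nat.add (bit (support 5))
        (bit (support 6)))))))))) 16

theorem offsetValid_iff {m c₀ c₁ c₂ l : Nat} :
    offsetValid m c₀ c₁ c₂ l = true ↔
      counter c₀ c₁ c₂ l + m + (Finset.filter (fun i => coeff l i ≠ 0) (Finset.range 7)).card
        ≤ 16 := by
  have hbit (a : Nat) : Nat.land 1 (Nat.shiftRight a l) = (a.testBit l).toNat := by
    have := Nat.toNat_testBit a l
    rw [this, ← Nat.shiftRight_eq_div_pow, ← Nat.one_and_eq_mod_two]
    rfl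
  have hs (i : ℕ) (hi : 0 < i) : ((support i).testBit l).toNat = if coeff l i ≠ 0 then 1 else 0 := by
    simp only [← testBit_support l hi]
    cases (support i).testBit l <;> rfl
  rw [offsetValid, Finset.card_filter]
  simp only [hbit, Nat.ble_eq, hs _ Nat.zero_lt_one, hs 2 (by decide), hs 3 (by decide),
    hs 4 (by decide), hs 5 (by decide), hs 6 (by decide), Finset.sum_range_succ,
    Finset.sum_range_zero, counter, Nat.add_eq, Nat.mul_eq]
  rw [if_pos (show coeff l 0 ≠ 0 from one_ne_zero)]
  exact iff_of_eq (congrArg (· ≤ 16) (by ring))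

/-- The windows prescribed by `laneBound` are those listed in `act`. -/
abbrev WindowsValid (m : ℕ) (act : List Nat) : Prop :=
  ∀ j < act.length, act.getD j 0 =
    Nat.xor (2 ^ laneBound j - 1) (if m ≤ j then 2 ^ laneBound (j - m) - 1 else 0)

theorem exists_start {m : ℕ} {act : List Nat} (hact : WindowsValid m act) {l : ℕ} (hl : l < 939) :
    ∃ s < 7, (∀ i < 7, s < i → coeff l i = 0) ∧
      ∀ j < act.length, (act.getD j 0).testBit l = true → s ≤ j ∧ j < s + m := by
  obtain ⟨s, hs, hlt⟩ : ∃ s, l < laneBound s ∧ ∀ j, l < laneBound j ↔ s ≤ j := by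
    classical
    have hex : ∃ s, l < laneBound s := ⟨6, hl⟩
    exact ⟨Nat.find hex, Nat.find_spec hex, fun j =>
      ⟨fun h => Nat.find_min' hex h, fun h => (Nat.find_spec hex).trans_le (laneBound_mono h)⟩⟩
  refine ⟨s, Nat.lt_succ_of_le ((hlt 6).1 hl), fun i hi his => coeff_eq_zero_of_lt hs his hi,
    fun j hj h => ?_⟩
  rw [hact j hj] at h
  have h' := (Nat.testBit_xor ..).symm.trans h
  rw [Nat.testBit_two_pow_sub_one] at h'
  split_ifs at h' with hm
  · rw [Nat.testBit_two_pow_sub_one] at h'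
    simp only [hlt] at h'
    by_cases h1 : s ≤ j <;> by_cases h2 : s ≤ j - m <;> simp [h1, h2] at h' <;> omega
  · rw [Nat.zero_testBit] at h'
    simp only [hlt, Bool.xor_false, decide_eq_true_eq] at h'
    omega

theorem laneVal_eq {t : ℕ → Q4} {l s j : ℕ} (hs : s < 7) (hl : ∀ i < 7, s < i → coeff l i = 0)
    (hj : s ≤ j) : laneVal t l j = ∑ i ∈ Finset.range (s + 1), coeff l i * t (j - i) := by
  rw [laneVal, ← Finset.sum_subset (Finset.range_mono (show s + 1 ≤ 7 by omega))]
  · refine Finset.sum_congr rfl fun i hi => ?_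
    rw [Finset.mem_range] at hi
    rw [back, if_pos (by omega)]
  · intro i hi hi'
    rw [Finset.mem_range] at hi hi'
    rw [hl i hi (by omega), zero_mul]

theorem counter_le (c₀ c₁ c₂ l : Nat) : counter c₀ c₁ c₂ l ≤ 7 := by
  have := Bool.toNat_le (c₀.testBit l)
  have := Bool.toNat_le (c₁.testBit l)
  have := Bool.toNat_le (c₂.testBit l)
  rw [counter]
  omega

/-- Bounded universal quantification, evaluated by recursion. -/
noncomputable def allBelow (p : Nat → Bool) (n : Nat) : Bool :=
  Nat.rec (motive := fun _ => Bool) true (fun l ih => andThen (p l) ih) n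

theorem allBelow_eq_true {p : Nat → Bool} {n : Nat} (h : allBelow p n = true) :
    ∀ l < n, p l = true := by
  induction n with
  | zero => simp
  | succ n ih =>
    obtain ⟨h1, h2⟩ := andThen_eq_true.1 (show andThen (p n) (allBelow p n) = true from h)
    intro l hl
    rcases Nat.lt_succ_iff_lt_or_eq.mp hl with hl | rfl
    exacts [ih h2 l hl, h1]

set_option exponentiation.threshold 1000 in
theorem not_hasCode_of_search {m : ℕ} {act : List Nat} {c₀ c₁ c₂ : Nat} (hm : 7 ≤ m)
    (hlen : act.length ≤ 2 * m - 6) (h6 : 6 ≤ act.length)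
    (hact : WindowsValid m act) (hlt : ∀ a ∈ act, a < 2 ^ 939)
    (hoffset : allBelow (offsetValid m c₀ c₁ c₂) 939 = true)
    (hsearch : (seeds.all (searchSeed act c₀ c₁ c₂)) = true) :
    ¬ HasCode m Q4 := by
  intro h
  obtain ⟨t₀, ht₀⟩ := h.exists_windowBound (by omega)
  obtain ⟨t, ht, hfirst, seed, hseed, hst⟩ := ht₀.exists_seed
  have hsl : seed.length ≤ act.length := by
    refine le_trans ?_ h6
    have h : ∀ l ∈ seeds, l.length ≤ 6 := by decide
    exact h seed hseed
  have hlast (a : Nat) (j : ℕ) (hj : act.length ≤ j) : (act.getD j 0).testBit a = false := by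
    simp [List.getD_eq_getElem?_getD, hj]
  refine search_sound (act := fun j => act.getD j 0) (b := counter c₀ c₁ c₂) hfirst _ 0 true
    c₀ c₁ c₂ (List.all_eq_true.1 hsearch seed hseed) (fun k hk => ?_) (fun l => by simp [zeroCount])
    (fun l k _ => ?_) (by simp)
  · simp only [List.length_zip, List.length_append, List.length_replicate] at hk
    simp only [List.getElem_zip, zero_add]
    refine ⟨by rw [List.getD_eq_getElem _ _ (by omega)], ?_⟩
    rw [List.getElem_append]
    split_ifs with hks
    · exact hst k hks
    · simp
  · by_cases hl : l < 939
    · have hwt := offsetValid_iff.1 (allBelow_eq_true hoffset l hl)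
      obtain ⟨s, hs7, hsupp, hwin⟩ := exists_start hact hl
      have hb := ht (coeff l) s s one_ne_zero (by omega) le_rfl
      have h1 : zeroCount (fun j => act.getD j 0) t l k ≤
          (Finset.filter (fun j => s ≤ j ∧ j < s + m ∧
            ∑ i ∈ Finset.range (s + 1), coeff l i * t (j - i) = 0)
            (Finset.range (2 * m - 1 - 5))).card := by
        refine Finset.card_le_card fun j hj => ?_
        simp only [Finset.mem_filter, Finset.mem_range] at hj ⊢
        obtain ⟨hjk, hja, hj0⟩ := hj
        have hjl : j < act.length := by
          by_contra hc
          rw [hlast l j (by omega)] at hja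
          exact absurd hja (by decide)
        obtain ⟨h1, h2⟩ := hwin j hjl hja
        rw [laneVal_eq hs7 hsupp h1] at hj0
        exact ⟨by omega, h1, h2, hj0⟩
      have h2 : (Finset.filter (fun i => coeff l i ≠ 0) (Finset.range (s + 1))).card ≤
          (Finset.filter (fun i => coeff l i ≠ 0) (Finset.range 7)).card :=
        Finset.card_le_card (Finset.filter_subset_filter _
          (Finset.range_mono (show s + 1 ≤ 7 by omega)))
      omega
    · have h0 : zeroCount (fun j => act.getD j 0) t l k = 0 := by
        rw [zeroCount, Finset.card_eq_zero, Finset.filter_eq_empty_iff]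
        rintro j - ⟨hj, -⟩
        by_cases hja : j < act.length
        · rw [List.getD_eq_getElem _ _ hja] at hj
          have := hlt _ (List.getElem_mem hja)
          rw [Nat.testBit_lt_two_pow (this.trans_le
            (Nat.pow_le_pow_right (by decide) (by omega)))] at hj
          exact absurd hj (by decide)
        · rw [hlast l j (by omega)] at hj
          exact absurd hj (by decide)
      have := counter_le c₀ c₁ c₂ l
      omega

set_option exponentiation.threshold 1000 in
set_option maxRecDepth 10000 in
theorem not_hasCode_eight : ¬ HasCode 8 Q4 := by
  apply not_hasCode_of_search (act := windows8) (c₀ := offset8_0) (c₁ := offset8_1)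
    (c₂ := offset8_2) <;> decide +kernel

set_option exponentiation.threshold 1000 in
set_option maxRecDepth 10000 in
theorem not_hasCode_nine : ¬ HasCode 9 Q4 := by
  apply not_hasCode_of_search (act := windows9) (c₀ := offset9_0) (c₁ := offset9_1)
    (c₂ := offset9_2) <;> decide +kernel

set_option exponentiation.threshold 1000 in
set_option maxRecDepth 10000 in
theorem not_hasCode_ten : ¬ HasCode 10 Q4 := by
  apply not_hasCode_of_search (act := windows10) (c₀ := offset10_0) (c₁ := offset10_1)
    (c₂ := offset10_2) <;> decide +kernel

set_option exponentiation.threshold 1000 in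
set_option maxRecDepth 10000 in
theorem not_hasCode_eleven : ¬ HasCode 11 Q4 := by
  apply not_hasCode_of_search (act := windows11) (c₀ := offset11_0) (c₁ := offset11_1)
    (c₂ := offset11_2) <;> decide +kernel

/-- Whether the natural number `n` has at least `d` binary digits `1`. -/
noncomputable def weightGe (d : Nat) : Nat → Bool :=
  Nat.rec (motive := fun _ => Nat → Bool) (fun _ => true)
    (fun _ ih n => Bool.rec (motive := fun _ => Bool) (ih (Nat.land n (Nat.sub n 1))) false
      (Nat.beq n 0)) d

theorem le_card_of_weightGe {d n : Nat} (h : weightGe d n = true) (s : Finset ℕ)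
    (hs : ∀ j, n.testBit j = true → j ∈ s) : d ≤ s.card := by
  induction d generalizing n s with
  | zero => exact Nat.zero_le _
  | succ d ih =>
    replace h : Bool.rec (motive := fun _ => Bool) (weightGe d (Nat.land n (Nat.sub n 1))) false
      (Nat.beq n 0) = true := h
    cases hn : Nat.beq n 0
    · rw [hn] at h
      have hn0 : n ≠ 0 := Nat.ne_of_beq_eq_false hn
      have hand (j : ℕ) : (Nat.land n (Nat.sub n 1)).testBit j =
          (n.testBit j && (Nat.sub n 1).testBit j) := Nat.testBit_and ..
      obtain ⟨j, hj⟩ : ∃ j, n.testBit j = true ∧ (Nat.land n (Nat.sub n 1)).testBit j = false := by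
        by_contra! hc
        have : Nat.land n (Nat.sub n 1) = n := Nat.eq_of_testBit_eq fun j => by
          have := hc j
          rw [hand] at this ⊢
          revert this
          cases n.testBit j <;> simp
        have hle : Nat.land n (Nat.sub n 1) ≤ n - 1 := Nat.and_le_right
        omega
      have := ih h (s.erase j) fun i hi => by
        refine Finset.mem_erase.2 ⟨?_, hs i ?_⟩
        · rintro rfl
          rw [hj.2] at hi
          exact absurd hi (by decide)
        · rw [hand, Bool.and_eq_true] at hi
          exact hi.1
      rw [Finset.card_erase_of_mem (hs j hj.1)] at this
      have : 0 < s.card := Finset.card_pos.2 ⟨j, hs j hj.1⟩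
      omega
    · rw [hn] at h
      exact (Bool.false_ne_true h).elim

/-- Whether adding at most `k` multiples of the first `n` rows of the Hankel matrix given by `lo` and
`hi` to the vector given by `p` and `q` always leaves `b + k` nonzero coordinates, reduced by the
number of rows used. -/
noncomputable def combine (b lo hi mask n : Nat) : Nat → Nat → Nat → Bool :=
  Nat.rec (motive := fun _ => Nat → Nat → Nat → Bool)
    (fun k p q => weightGe (Nat.add b k) (Nat.land mask (Nat.lor p q)))
    (fun n ih k => Nat.rec (motive := fun _ => Nat → Nat → Bool)
      (fun p q => weightGe b (Nat.land mask (Nat.lor p q)))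
      (fun k _ p q => andThen (ih (Nat.succ k) p q)
        ((fun r s => andThen (ih k (Nat.xor p r) (Nat.xor q s))
          (andThen (ih k (Nat.xor p s) (Nat.xor q (Nat.xor r s)))
            (ih k (Nat.xor p (Nat.xor r s)) (Nat.xor q r))))
          (Nat.shiftRight lo n) (Nat.shiftRight hi n))) k) n

/-- The `j`-th symbol of the sequence encoded by the binary numbers `p` and `q`. -/
def symbol (p q j : Nat) : Q4 := Q4.ofBits (p.testBit j) (q.testBit j)

theorem Q4.ofBits_xor : ∀ a b c d : Bool,
    ofBits (a ^^ c) (b ^^ d) = ofBits a b + ofBits c d := by decide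

theorem Q4.ofBits_w_mul : ∀ a b : Bool, w * ofBits a b = ofBits b (a ^^ b) := by decide

theorem Q4.ofBits_v_mul : ∀ a b : Bool, v * ofBits a b = ofBits (a ^^ b) a := by decide

theorem symbol_xor (p q r s j : Nat) :
    symbol (Nat.xor p r) (Nat.xor q s) j = symbol p q j + symbol r s j := by
  have h (a b : Nat) : (Nat.xor a b).testBit j = (a.testBit j ^^ b.testBit j) := Nat.testBit_xor ..
  rw [symbol, h, h, Q4.ofBits_xor]
  rfl

theorem symbol_shiftRight (lo hi n j : Nat) :
    symbol (Nat.shiftRight lo n) (Nat.shiftRight hi n) j = symbol lo hi (n + j) := by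
  have h (a : Nat) : (Nat.shiftRight a n).testBit j = a.testBit (n + j) := Nat.testBit_shiftRight ..
  rw [symbol, h, h]
  rfl

theorem w_mul_symbol (r s j : Nat) : Q4.w * symbol r s j = symbol s (Nat.xor r s) j := by
  have h (a b : Nat) : (Nat.xor a b).testBit j = (a.testBit j ^^ b.testBit j) := Nat.testBit_xor ..
  rw [symbol, symbol, h, Q4.ofBits_w_mul]

theorem v_mul_symbol (r s j : Nat) : Q4.v * symbol r s j = symbol (Nat.xor r s) r j := by
  have h (a b : Nat) : (Nat.xor a b).testBit j = (a.testBit j ^^ b.testBit j) := Nat.testBit_xor ..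
  rw [symbol, symbol, h, Q4.ofBits_v_mul]

open Finset in
theorem le_card_symbol_of_weightGe {d m p q : Nat}
    (h : weightGe d (Nat.land (2 ^ m - 1) (Nat.lor p q)) = true) :
    d ≤ #{j ∈ range m | symbol p q j ≠ 0} := by
  refine le_card_of_weightGe h _ fun j hj => ?_
  have h1 : (Nat.land (2 ^ m - 1) (Nat.lor p q)).testBit j =
    ((2 ^ m - 1).testBit j && (Nat.lor p q).testBit j) := Nat.testBit_and ..
  have h2 : (Nat.lor p q).testBit j = (p.testBit j || q.testBit j) := Nat.testBit_or ..
  rw [h1, h2, Nat.testBit_two_pow_sub_one, Bool.and_eq_true, decide_eq_true_eq] at hj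
  rw [mem_filter, mem_range, symbol, ne_eq, Q4.ofBits_eq_zero_iff, Bool.not_eq_false]
  exact hj

open Finset in
theorem combine_sound {b lo hi m : Nat} (n k p q : Nat)
    (h : combine b lo hi (2 ^ m - 1) n k p q = true) (x : ℕ → Q4)
    (hx : #{i ∈ range n | x i ≠ 0} ≤ k) :
    b + k ≤ #{i ∈ range n | x i ≠ 0} +
      #{j ∈ range m | symbol p q j + ∑ i ∈ range n, x i * symbol lo hi (i + j) ≠ 0} := by
  induction n generalizing k p q with
  | zero =>
    simpa using le_card_symbol_of_weightGe (d := b + k) h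
  | succ n ih =>
    cases k with
    | zero =>
      have h0 : ∀ i ∈ range (n + 1), x i = 0 := by
        simpa [filter_eq_empty_iff] using hx
      have hsum (j : ℕ) : ∑ i ∈ range (n + 1), x i * symbol lo hi (i + j) = 0 :=
        sum_eq_zero fun i hi => by rw [h0 i hi, zero_mul]
      have := le_card_symbol_of_weightGe (d := b) (p := p) (q := q) h
      simp only [hsum, add_zero] at this ⊢
      omega
    | succ k =>
      obtain ⟨hz, h⟩ := andThen_eq_true.1 h
      obtain ⟨ho, h⟩ := andThen_eq_true.1 h
      obtain ⟨hw, hv⟩ := andThen_eq_true.1 h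
      have hcard : #{i ∈ range (n + 1) | x i ≠ 0} =
          #{i ∈ range n | x i ≠ 0} + if x n ≠ 0 then 1 else 0 := by
        simp only [card_filter, sum_range_succ]
      have hsum (j : ℕ) : symbol p q j + ∑ i ∈ range (n + 1), x i * symbol lo hi (i + j) =
          (symbol p q j + x n * symbol (Nat.shiftRight lo n) (Nat.shiftRight hi n) j) +
            ∑ i ∈ range n, x i * symbol lo hi (i + j) := by
        rw [sum_range_succ, symbol_shiftRight]
        ring
      rw [hcard] at hx ⊢
      simp only [hsum]
      by_cases hxn : x n = 0
      · rw [if_neg (not_not.2 hxn)] at hx ⊢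
        simpa [hxn] using ih (k + 1) p q hz hx
      · rw [if_pos hxn] at hx ⊢
        have hx' := Nat.le_of_succ_le_succ hx
        have key : b + k ≤ #{i ∈ range n | x i ≠ 0} + #{j ∈ range m | (symbol p q j +
            x n * symbol (Nat.shiftRight lo n) (Nat.shiftRight hi n) j) +
            ∑ i ∈ range n, x i * symbol lo hi (i + j) ≠ 0} := by
          rcases hc : x n with _ | _ | _ | _
          · exact absurd hc hxn
          · have := ih k _ _ ho hx'
            simp only [symbol_xor] at this
            rw [show Q4.o = 1 from rfl]
            simpa only [one_mul] using this
          · have := ih k _ _ hw hx'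
            simp only [symbol_xor p q] at this
            simpa only [w_mul_symbol] using this
          · have := ih k _ _ hv hx'
            simp only [symbol_xor p q] at this
            simpa only [v_mul_symbol] using this
        omega

/-- The vector of length `m` encoded by the binary numbers `lo` and `hi`. -/
def symbols (lo hi m : Nat) : Fin m → Q4 := fun i => symbol lo hi i

theorem wt_shift {m : ℕ} [NeZero m] (x : Fin m → Q4) {c : Q4} (hc : c ≠ 0) (d : Fin m) :
    wt (fun i => c * x (i + d)) = wt x :=
  Nat.card_congr ((Equiv.addRight d).subtypeEquiv fun i => by simp [hc])

open Finset in
theorem wt_eq_card_range {m : ℕ} {x : Fin m → Q4} {y : ℕ → Q4} (h : ∀ i : Fin m, y i = x i) :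
    wt x = #{i ∈ range m | y i ≠ 0} := by
  rw [wt_eq_card, card_filter, card_filter, sum_range]
  simp only [h]

theorem vecMul_circulant_shift {m : ℕ} [NeZero m] (x v : Fin m → Q4) (c : Q4) (d : Fin m) :
    Matrix.vecMul (fun i => c * x (i + d)) (Matrix.circulant v) =
      fun j => c * Matrix.vecMul x (Matrix.circulant v) (j + d) := by
  ext j
  simp only [Matrix.vecMul, dotProduct, Matrix.circulant_apply, Finset.mul_sum]
  refine Fintype.sum_equiv (Equiv.addRight d) _ _ fun i => ?_
  rw [Equiv.coe_addRight, add_sub_add_right_eq_sub, mul_assoc]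

/-- The check of all combinations of few rows of the circulant matrix given by `lo` and `hi`. -/
noncomputable def circulantCheck (b lo hi m k : Nat) : Bool :=
  combine b lo hi (2 ^ m - 1) (m - 1) k (Nat.shiftRight lo (m - 1)) (Nat.shiftRight hi (m - 1))

open Finset in
theorem le_wt_of_circulantCheck {b lo hi m k : Nat} [NeZero m]
    (h : circulantCheck b lo hi m k = true)
    (hper : ∀ i < m, symbol lo hi (i + m) = symbol lo hi i) (x : Fin m → Q4) (hx : x ≠ 0)
    (hwt : wt x ≤ k + 1) :
    b + k + 1 ≤ wt x + wt (Matrix.vecMul x (Matrix.circulant (symbols lo hi m))) := by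
  have hm := NeZero.pos m
  obtain ⟨i₀, hi₀⟩ := Function.ne_iff.1 hx
  let e : Fin m := ⟨m - 1, by omega⟩
  obtain ⟨x', hx'⟩ : ∃ x' : Fin m → Q4, x' = fun i => (x i₀)⁻¹ * x (i + (i₀ - e)) := ⟨_, rfl⟩
  have hc : (x i₀)⁻¹ ≠ 0 := inv_ne_zero hi₀
  have hwt' : wt x' = wt x := by rw [hx', wt_shift x hc]
  have hone : x' e = 1 := by
    rw [hx']
    simp only [add_sub_cancel]
    exact inv_mul_cancel₀ hi₀
  have hvec : wt (Matrix.vecMul x' (Matrix.circulant (symbols lo hi m))) =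
      wt (Matrix.vecMul x (Matrix.circulant (symbols lo hi m))) := by
    rw [hx', vecMul_circulant_shift, wt_shift _ hc]
  rw [← hvec, ← hwt']
  rw [← hwt'] at hwt
  let X : ℕ → Q4 := fun i => if hi : i < m then x' ⟨i, hi⟩ else 0
  have hX (i : Fin m) : X i = x' i := by simp [X]
  have hXe : X (m - 1) = 1 := (hX e).trans hone
  have hsum (f : ℕ → Q4) : ∑ i ∈ range m, X i * f i = f (m - 1) + ∑ i ∈ range (m - 1), X i * f i := by
    obtain ⟨m, rfl⟩ := Nat.exists_eq_succ_of_ne_zero hm.ne'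
    rw [sum_range_succ, add_comm]
    simp only [Nat.succ_eq_add_one, Nat.add_sub_cancel] at hXe ⊢
    rw [hXe, one_mul]
  have hcard : wt x' = #{i ∈ range (m - 1) | X i ≠ 0} + 1 := by
    rw [wt_eq_card_range hX]
    obtain ⟨m, rfl⟩ := Nat.exists_eq_succ_of_ne_zero hm.ne'
    simp only [Nat.succ_eq_add_one, Nat.add_sub_cancel, card_filter, sum_range_succ] at hXe ⊢
    simp [hXe]
  have hrow : wt (Matrix.vecMul x' (Matrix.circulant (symbols lo hi m))) =
      #{j ∈ range m | ∑ i ∈ range m, X i * symbol lo hi (i + j) ≠ 0} := by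
    have hneg : wt (Matrix.vecMul x' (Matrix.circulant (symbols lo hi m))) =
        wt fun j => Matrix.vecMul x' (Matrix.circulant (symbols lo hi m)) (-j) :=
      Nat.card_congr ((Equiv.neg _).subtypeEquiv fun i => by simp)
    rw [hneg]
    refine wt_eq_card_range fun j => ?_
    simp only [Matrix.vecMul, dotProduct, Matrix.circulant_apply, sub_neg_eq_add, sum_range, hX]
    refine sum_congr rfl fun i _ => ?_
    congr 1
    rw [symbols, Fin.val_add]
    by_cases hij : (i : ℕ) + j < m
    · rw [Nat.mod_eq_of_lt hij]
    · rw [← hper _ (Nat.mod_lt _ hm), Nat.mod_eq_sub_mod (by omega), Nat.mod_eq_of_lt (by omega)]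
      congr 1
      omega
  have key := combine_sound (m - 1) k _ _ h X (by omega)
  rw [hrow]
  simp only [hsum]
  simp only [symbol_shiftRight] at key
  omega

theorem isToeplitz_circulant {m : ℕ} [NeZero m] (v : Fin m → Q4) :
    IsToeplitz (Matrix.circulant v) := by
  intro i j i' j' h
  rw [Matrix.circulant_apply, Matrix.circulant_apply]
  congr 1
  rw [sub_eq_sub_iff_add_eq_add]
  ext
  rw [Fin.val_add, Fin.val_add, h]

theorem hasCode_of_circulant {m lo hi lo' hi' : Nat} [NeZero m]
    (hper : ∀ i < m, symbol lo hi (i + m) = symbol lo hi i)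
    (hper' : ∀ i < m, symbol lo' hi' (i + m) = symbol lo' hi' i)
    (hinv : ∀ i : Fin m, ∑ j, symbols lo hi m (i - j) * symbols lo' hi' m j =
      if i = 0 then 1 else 0)
    (h : circulantCheck 5 lo hi m 3 = true) (h' : circulantCheck 6 lo' hi' m 2 = true) :
    HasCode m Q4 := by
  refine ⟨Matrix.circulant (symbols lo hi m), isToeplitz_circulant _, fun x hx => ?_⟩
  have hmul : Matrix.circulant (symbols lo hi m) * Matrix.circulant (symbols lo' hi' m) = 1 := by
    rw [Matrix.circulant_mul, ← Matrix.circulant_single_one Q4 (Fin m)]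
    congr 1
    ext i
    rw [Pi.single_apply]
    exact hinv i
  obtain ⟨y, hy⟩ : ∃ y, y = Matrix.vecMul x (Matrix.circulant (symbols lo hi m)) := ⟨_, rfl⟩
  have hyx : Matrix.vecMul y (Matrix.circulant (symbols lo' hi' m)) = x := by
    rw [hy, Matrix.vecMul_vecMul, hmul, Matrix.vecMul_one]
  have hy0 : y ≠ 0 := fun h0 => hx (by rw [← hyx, h0, Matrix.zero_vecMul])
  rw [← hy]
  by_cases h4 : wt x ≤ 4
  · have := le_wt_of_circulantCheck h hper x hx h4
    rwa [← hy] at this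
  · by_cases h3 : wt y ≤ 3
    · have := le_wt_of_circulantCheck h' hper' y hy0 h3
      rw [hyx] at this
      omega
    · omega

set_option maxRecDepth 10000 in
theorem hasCode_twelve : HasCode 12 Q4 := by
  refine hasCode_of_circulant (lo := 475252) (hi := 12147605)
    (lo' := 12811319) (hi' := 2847415) ?_ ?_ ?_ ?_ ?_ <;> decide +kernel

set_option maxRecDepth 10000 in
theorem hasCode_thirteen : HasCode 13 Q4 := by
  refine hasCode_of_circulant (lo := 5169783) (hi := 17426511)
    (lo' := 35107005) (hi' := 63438399) ?_ ?_ ?_ ?_ ?_ <;> decide +kernel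

set_option maxRecDepth 10000 in
theorem hasCode_fourteen : HasCode 14 Q4 := by
  refine hasCode_of_circulant (lo := 211546735) (hi := 134586390)
    (lo' := 200093620) (hi' := 261979765) ?_ ?_ ?_ ?_ ?_ <;> decide +kernel

set_option maxRecDepth 10000 in
theorem hasCode_fifteen : HasCode 15 Q4 := by
  refine hasCode_of_circulant (lo := 764893998) (hi := 521813556)
    (lo' := 842622066) (hi' := 277717275) ?_ ?_ ?_ ?_ ?_ <;> decide +kernel

set_option maxRecDepth 10000 in
theorem hasCode_sixteen : HasCode 16 Q4 := by
  refine hasCode_of_circulant (lo := 1707697609) (hi := 4085314432)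
    (lo' := 1895198966) (hi' := 4187158930) ?_ ?_ ?_ ?_ ?_ <;> decide +kernel

set_option maxRecDepth 10000 in
theorem hasCode_seventeen : HasCode 17 Q4 := by
  refine hasCode_of_circulant (lo := 13172443281) (hi := 14585017002)
    (lo' := 5383430256) (hi' := 6846598155) ?_ ?_ ?_ ?_ ?_ <;> decide +kernel

set_option maxRecDepth 10000 in
theorem hasCode_eighteen : HasCode 18 Q4 := by
  refine hasCode_of_circulant (lo := 48951908720) (hi := 33395700130)
    (lo' := 2626692900) (hi' := 31864249040) ?_ ?_ ?_ ?_ ?_ <;> decide +kernel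

set_option maxRecDepth 10000 in
theorem hasCode_nineteen : HasCode 19 Q4 := by
  refine hasCode_of_circulant (lo := 82939898355) (hi := 176271204690)
    (lo' := 254544930945) (hi' := 231542799648) ?_ ?_ ?_ ?_ ?_ <;> decide +kernel

set_option maxRecDepth 10000 in
theorem hasCode_twenty : HasCode 20 Q4 := by
  refine hasCode_of_circulant (lo := 133431423250) (hi := 770499622485)
    (lo' := 103584727522) (hi' := 1057636705280) ?_ ?_ ?_ ?_ ?_ <;> decide +kernel

set_option maxRecDepth 10000 in
theorem hasCode_twentyOne : HasCode 21 Q4 := by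
  refine hasCode_of_circulant (lo := 331759118835) (hi := 2904108114258)
    (lo' := 3110239379781) (hi' := 1657805737959) ?_ ?_ ?_ ?_ ?_ <;> decide +kernel

/-- The additive map sending the sequence of diagonals of a Toeplitz matrix `A` to the product
`xA`. -/
def toeplitzMul {m : ℕ} (x : Fin m → Q4) : (Fin (2 * m - 1) → Q4) →+ (Fin m → Q4) where
  toFun t j := ∑ i : Fin m, x i * t ⟨j + (m - 1) - i, by omega⟩
  map_zero' := by ext; simp
  map_add' _ _ := by ext; simp [mul_add, Finset.sum_add_distrib]

open Finset in
theorem toeplitzMul_surjective {m : ℕ} {x : Fin m → Q4} (hx : x ≠ 0) :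
    Function.Surjective (toeplitzMul x) := by
  obtain ⟨i₀, hi₀, hlt⟩ : ∃ i₀, x i₀ ≠ 0 ∧ ∀ i < i₀, x i = 0 := by
    have hne : (univ.filter fun i => x i ≠ 0).Nonempty := by
      obtain ⟨i, hi⟩ := Function.ne_iff.1 hx
      exact ⟨i, by simpa using hi⟩
    refine ⟨_, (mem_filter.1 (min'_mem _ hne)).2, fun i hi => ?_⟩
    by_contra h
    exact absurd (min'_le _ i (by simpa using h)) (not_le.2 hi)
  intro y
  suffices h : ∀ n, ∃ t : ℕ → Q4, ∀ j : Fin m, (j : ℕ) < n →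
      ∑ i : Fin m, x i * t (j + (m - 1) - i) = y j by
    obtain ⟨t, ht⟩ := h m
    exact ⟨fun k => t k, funext fun j => ht j j.2⟩
  intro n
  induction n with
  | zero => exact ⟨0, by simp⟩
  | succ n ih =>
    obtain ⟨t, ht⟩ := ih
    by_cases hn : n < m
    · obtain ⟨s, hs⟩ : ∃ s, s = ∑ i ∈ univ.erase i₀, x i * t (n + (m - 1) - i) := ⟨_, rfl⟩
      refine ⟨Function.update t (n + (m - 1) - i₀) ((x i₀)⁻¹ * (y ⟨n, hn⟩ - s)), fun j hj => ?_⟩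
      rcases Nat.lt_succ_iff_lt_or_eq.1 hj with hj | hj
      · rw [← ht j hj]
        refine sum_congr rfl fun i _ => ?_
        rcases lt_or_ge i i₀ with hi | hi
        · rw [hlt i hi, zero_mul, zero_mul]
        · rw [Function.update_of_ne]
          have : (i₀ : ℕ) ≤ i := hi
          omega
      · obtain rfl : j = ⟨n, hn⟩ := Fin.ext hj
        rw [← add_sum_erase _ _ (mem_univ i₀), Function.update_self, mul_inv_cancel_left₀ hi₀]
        have : ∑ i ∈ univ.erase i₀, x i * Function.update t (n + (m - 1) - i₀)
            ((x i₀)⁻¹ * (y ⟨n, hn⟩ - s)) (n + (m - 1) - i) = s := by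
          rw [hs]
          refine sum_congr rfl fun i hi => ?_
          rw [Function.update_of_ne]
          have : (i : ℕ) ≠ i₀ := fun h => (mem_erase.1 hi).1 (Fin.ext h)
          omega
        rw [this, sub_add_cancel]
    · exact ⟨t, fun j _ => ht j (by omega)⟩

open Finset in
theorem AddMonoidHom.sum_comp_mul_card {G H : Type*} [AddGroup G] [AddGroup H] [Fintype G]
    [Fintype H] (f : G →+ H) (hf : Function.Surjective f) (g : H → ℚ) :
    (∑ t, g (f t)) * Fintype.card H = Fintype.card G * ∑ y, g y := by
  classical
  have hfib (y : H) : #{t | f t = y} = #{t | f t = 0} :=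
    AddMonoidHom.card_fiber_eq_of_mem_range f (hf y) (hf 0)
  have hsum (g : H → ℚ) : ∑ t, g (f t) = #{t | f t = 0} * ∑ y, g y := by
    rw [← sum_fiberwise univ f, mul_sum]
    refine sum_congr rfl fun y _ => ?_
    rw [← hfib y, ← nsmul_eq_mul, ← sum_const]
    exact sum_congr rfl fun t ht => by rw [(mem_filter.1 ht).2]
  have h1 := hsum fun _ => 1
  simp only [sum_const, card_univ, nsmul_eq_mul, mul_one] at h1
  rw [hsum, h1]
  ring

theorem sum_pow_wt (m : ℕ) (z : ℚ) : ∑ v : Fin m → Q4, z ^ wt v = (1 + 3 * z) ^ m := by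
  have hz (v : Fin m → Q4) : z ^ wt v = ∏ i, if v i ≠ 0 then z else 1 := by
    rw [wt_eq_card, Finset.prod_ite]
    simp
  have hone : ∑ a : Q4, (if a ≠ 0 then z else 1) = 1 + 3 * z := by
    rw [show (Finset.univ : Finset Q4) = {0, 1, Q4.w, Q4.v} from rfl]
    rw [Finset.sum_insert (by decide), Finset.sum_insert (by decide),
      Finset.sum_insert (by decide), Finset.sum_singleton, if_neg (by decide),
      if_pos (by decide), if_pos (by decide), if_pos (by decide)]
    ring
  simp only [hz]
  rw [← Fintype.piFinset_univ, Finset.sum_prod_piFinset Finset.univ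
    fun _ a => if a ≠ 0 then z else 1]
  simp only [hone, Finset.prod_const, Finset.card_univ, Fintype.card_fin]

open Finset in
/-- The Gilbert–Varshamov argument for double Toeplitz codes. -/
theorem hasCode_of_ge {m : ℕ} (hm : 22 ≤ m) : HasCode m Q4 := by
  obtain ⟨t, ht⟩ : ∃ t : Fin (2 * m - 1) → Q4,
      ∀ x : Fin m → Q4, x ≠ 0 → 9 ≤ wt x + wt (toeplitzMul x t) := by
    by_contra! hbad
    have hcard (n : ℕ) : (Fintype.card (Fin n → Q4) : ℚ) = 4 ^ n := by
      rw [Fintype.card_fun, Q4.card_eq, Fintype.card_fin]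
      norm_num
    have hlow (t : Fin (2 * m - 1) → Q4) : (1 : ℚ) ≤ 12 ^ 8 *
        ∑ x ∈ univ.erase (0 : Fin m → Q4),
          (1 / 12) ^ wt x * (1 / 12) ^ wt (toeplitzMul x t) := by
      obtain ⟨x, hx, hlt⟩ := hbad t
      refine le_trans ?_ (mul_le_mul_of_nonneg_left (single_le_sum (fun x _ => by positivity)
        (mem_erase.2 ⟨hx, mem_univ x⟩)) (by norm_num))
      rw [← pow_add]
      calc (1 : ℚ) = 12 ^ 8 * (1 / 12) ^ 8 := by norm_num
        _ ≤ _ := mul_le_mul_of_nonneg_left (pow_le_pow_of_le_one (by norm_num) (by norm_num)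
            (Nat.le_of_lt_succ hlt)) (by norm_num)
    have hrow (x : Fin m → Q4) (hx : x ≠ 0) :
        (∑ t, (1 / 12 : ℚ) ^ wt (toeplitzMul x t)) * 4 ^ m = 4 ^ (2 * m - 1) * (5 / 4) ^ m := by
      have := (toeplitzMul x).sum_comp_mul_card (toeplitzMul_surjective hx)
        fun y => (1 / 12 : ℚ) ^ wt y
      rw [hcard, hcard, sum_pow_wt] at this
      rw [this]
      norm_num
    have hup : (4 : ℚ) ^ (2 * m - 1) * 4 ^ m ≤
        12 ^ 8 * (4 ^ (2 * m - 1) * ((5 / 4) ^ m * (5 / 4) ^ m)) := by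
      calc (4 : ℚ) ^ (2 * m - 1) * 4 ^ m = (∑ _t : Fin (2 * m - 1) → Q4, 1) * 4 ^ m := by
            rw [← hcard (2 * m - 1)]
            simp
        _ ≤ (∑ t, 12 ^ 8 * ∑ x ∈ univ.erase (0 : Fin m → Q4),
              (1 / 12) ^ wt x * (1 / 12) ^ wt (toeplitzMul x t)) * 4 ^ m :=
            mul_le_mul_of_nonneg_right (sum_le_sum fun t _ => hlow t) (by positivity)
        _ = 12 ^ 8 * ∑ x ∈ univ.erase (0 : Fin m → Q4),
              (1 / 12) ^ wt x * (4 ^ (2 * m - 1) * (5 / 4) ^ m) := by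
            rw [← mul_sum, sum_comm, mul_assoc, sum_mul]
            congr 1
            refine sum_congr rfl fun x hx => ?_
            rw [← hrow x (mem_erase.1 hx).1, ← mul_sum, mul_assoc]
        _ ≤ 12 ^ 8 * ∑ x : Fin m → Q4, (1 / 12) ^ wt x * (4 ^ (2 * m - 1) * (5 / 4) ^ m) :=
            mul_le_mul_of_nonneg_left (sum_le_sum_of_subset_of_nonneg (erase_subset _ _)
              fun _ _ _ => by positivity) (by norm_num)
        _ = _ := by
            rw [← sum_mul, sum_pow_wt]
            norm_num
            ring
    have hpow : (12 : ℚ) ^ 8 < (64 / 25) ^ m :=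
      lt_of_lt_of_le (by norm_num) (pow_le_pow_right₀ (by norm_num) hm)
    have h4 : (4 : ℚ) ^ m = (64 / 25) ^ m * ((5 / 4) ^ m * (5 / 4) ^ m) := by
      rw [← mul_pow, ← mul_pow]
      norm_num
    have hpos : (0 : ℚ) < 4 ^ (2 * m - 1) * ((5 / 4) ^ m * (5 / 4) ^ m) := by positivity
    have := mul_lt_mul_of_pos_right hpow hpos
    rw [h4] at hup
    linarith
  refine ⟨.of fun i j => t ⟨j + (m - 1) - i, by omega⟩, fun i j i' j' h => ?_, fun x hx => ht x hx⟩
  simp only [Matrix.of_apply]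
  congr 2
  omega

theorem not_hasCode_of_le {m : ℕ} (hm : 1 ≤ m) (h7 : m ≤ 7) : ¬ HasCode m Q4 := by
  rintro ⟨A, -, h⟩
  have hle (x : Fin m → Q4) : wt x ≤ m := by
    rw [wt_eq_card]
    exact (Finset.card_le_univ _).trans_eq (Fintype.card_fin m)
  let i : Fin m := ⟨0, hm⟩
  have h1 : wt (Pi.single i (1 : Q4)) ≤ 1 := by
    rw [wt_eq_card]
    refine (Finset.card_le_card fun j hj => ?_).trans_eq (Finset.card_singleton i)
    rw [Finset.mem_filter] at hj
    by_contra hji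
    exact hj.2 (Pi.single_eq_of_ne (by simpa using hji) _)
  have := h (Pi.single i 1) (by simp)
  have := hle (Matrix.vecMul (Pi.single i 1) A)
  omega

/-- Existence of a double Toeplitz code of length `2m` over the field with `4`
elements having minimum weight at least `9`, characterized by the length. -/
theorem stmt17 (F : Type*) [Field F] [Fintype F] (hF : Fintype.card F = 4)
    (m : ℕ) (hm : 1 ≤ m) :
    (∃ A : Matrix (Fin m) (Fin m) F, IsToeplitz A ∧
        ∀ c ∈ DTcode A, c ≠ 0 → 9 ≤ wt c) ↔ 24 ≤ 2 * m := by
  rw [← hasCode_iff, hasCode_iff_Q4 F hF]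
  constructor
  · intro h
    by_contra! hlt
    rcases Nat.lt_or_ge 7 m with h7 | h7
    · replace hlt : m < 12 := by omega
      interval_cases m
      exacts [not_hasCode_eight h, not_hasCode_nine h, not_hasCode_ten h, not_hasCode_eleven h]
    · exact not_hasCode_of_le hm h7 h
  · intro hge
    rcases Nat.lt_or_ge m 22 with h22 | h22
    · replace hge : 12 ≤ m := by omega
      interval_cases m
      exacts [hasCode_twelve, hasCode_thirteen, hasCode_fourteen, hasCode_fifteen,
        hasCode_sixteen, hasCode_seventeen, hasCode_eighteen, hasCode_nineteen, hasCode_twenty,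
        hasCode_twentyOne]
    · exact hasCode_of_ge h22
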